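/- Let k ≥ 1 and let G be a finite simple graph. Then G is W_k if and only if the following two conditions both hold: (1) G is well-covered, i.e., every maximal independent set of G is a maximum independent set; and (2) for any k pairwise disjoint independent vertex subsets A_1, …, A_k of G, there exist k pairwise disjoint maximal independent sets S_1, …, S_k of G with A_i ⊆ S_i for each i ∈ [k]. -/

import Mathlib

/-- A set of vertices is independent if no two of its vertices are adjacent. -/
def IsIndep {V : Type*} (G : SimpleGraph V) (A : Set V) : Prop :=
  A.Pairwise fun u v => ¬ G.Adj u v

/-- A maximum independent set: an independent set of maximum cardinality among
independent sets. -/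
def IsMaxIndep {V : Type*} (G : SimpleGraph V) (S : Set V) : Prop :=
  IsIndep G S ∧ ∀ T : Set V, IsIndep G T → T.ncard ≤ S.ncard

/-- A graph `G` is `W_k` if any `k` pairwise disjoint independent vertex subsets
`A_1, …, A_k` extend to `k` pairwise disjoint maximum independent sets
`S_1, …, S_k` with `A_i ⊆ S_i` for each `i`. -/
def IsWk {V : Type*} (G : SimpleGraph V) (k : ℕ) : Prop :=
  ∀ A : Fin k → Set V, (∀ i, IsIndep G (A i)) →
    (∀ i j, i ≠ j → Disjoint (A i) (A j)) →
    ∃ S : Fin k → Set V, (∀ i, IsMaxIndep G (S i)) ∧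
      (∀ i j, i ≠ j → Disjoint (S i) (S j)) ∧ ∀ i, A i ⊆ S i

/-- A maximal independent set: an independent set that is not a proper subset of another
independent set. -/
def IsMaximalIndep {V : Type*} (G : SimpleGraph V) (S : Set V) : Prop :=
  IsIndep G S ∧ ∀ T : Set V, IsIndep G T → S ⊆ T → S = T

/-- A graph is well-covered if every maximal independent set is a maximum independent set. -/
def WellCovered {V : Type*} (G : SimpleGraph V) : Prop :=
  ∀ S : Set V, IsMaximalIndep G S → IsMaxIndep G S

theorem IsMaxIndep.isMaximalIndep {V : Type*} [Finite V] {G : SimpleGraph V} {S : Set V}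
    (hS : IsMaxIndep G S) : IsMaximalIndep G S :=
  ⟨hS.1, fun T hT hST => Set.eq_of_subset_of_ncard_le hST (hS.2 T hT) T.toFinite⟩

theorem IsWk.wellCovered {V : Type*} {G : SimpleGraph V} {k : ℕ} (hk : 1 ≤ k)
    (h : IsWk G k) : WellCovered G := by
  intro S hS
  let i₀ : Fin k := ⟨0, hk⟩
  obtain ⟨T, hT, -, hAT⟩ := h (fun i => if i = i₀ then S else ∅)
    (fun i => by
      by_cases hi : i = i₀
      · simpa [hi] using hS.1
      · simp [hi, IsIndep])
    (fun i j hij => by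
      by_cases hi : i = i₀
      · have hj : j ≠ i₀ := fun hj => hij (hi.trans hj.symm)
        simp [hj]
      · simp [hi])
  have hST : S ⊆ T i₀ := by simpa using hAT i₀
  rw [hS.2 _ (hT i₀).1 hST]
  exact hT i₀

/-- `G` is `W_k` iff `G` is well-covered and any `k` pairwise disjoint independent sets
extend to `k` pairwise disjoint *maximal* independent sets. -/
theorem isWk_iff_wellCovered_and_maximal_ext {V : Type*} [Fintype V] (G : SimpleGraph V)
    (k : ℕ) (hk : 1 ≤ k) :
    IsWk G k ↔ WellCovered G ∧
      (∀ A : Fin k → Set V, (∀ i, IsIndep G (A i)) →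
        (∀ i j, i ≠ j → Disjoint (A i) (A j)) →
        ∃ S : Fin k → Set V, (∀ i, IsMaximalIndep G (S i)) ∧
          (∀ i j, i ≠ j → Disjoint (S i) (S j)) ∧ ∀ i, A i ⊆ S i) := by
  constructor
  · refine fun h => ⟨h.wellCovered hk, fun A hA hdisj => ?_⟩
    obtain ⟨S, hS, hSdisj, hAS⟩ := h A hA hdisj
    exact ⟨S, fun i => (hS i).isMaximalIndep, hSdisj, hAS⟩
  · rintro ⟨hwc, hext⟩ A hA hdisj
    obtain ⟨S, hS, hSdisj, hAS⟩ := hext A hA hdisj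
    exact ⟨S, fun i => hwc _ (hS i), hSdisj, hAS⟩
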